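/- Let α, β ∈ ℂ and let f = x^2 y (α x^7 + β y^7) ∈ V_10. Then the ten invariants j_2, j_4, j_6, A_6, B_6, j_8, j_9, j_10, A_12 and j_14 all vanish at f, while A_14(f) ≠ 0 if and only if α ≠ 0 and β ≠ 0. In particular, the invariant A_14 cannot be omitted from the eleven invariants j_2, j_4, j_6, A_6, B_6, j_8, j_9, j_10, A_12, j_14, A_14 defining the nullcone of V_10. -/

import Mathlib

open MvPolynomial

/-- The `k`-th transvectant of two binary forms `f` of degree `n` and `g` of degree `m`. -/
noncomputable def transv (n m k : ℕ)
    (f g : MvPolynomial (Fin 2) ℂ) : MvPolynomial (Fin 2) ℂ :=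
  ((((n - k).factorial * (m - k).factorial : ℕ) : ℂ) / ((n.factorial * m.factorial : ℕ) : ℂ)) •
    ∑ i ∈ Finset.range (k + 1),
      ((-1 : ℂ) ^ i * (k.choose i : ℂ)) •
        ((fun p => pderiv (0 : Fin 2) p)^[k - i] ((fun p => pderiv (1 : Fin 2) p)^[i] f) *
         (fun p => pderiv (0 : Fin 2) p)^[i] ((fun p => pderiv (1 : Fin 2) p)^[k - i] g))

/-- A binary form `f` has a root of multiplicity (at least) `r` if some nonzero linear
form `ℓ = αx + βy` satisfies `ℓ^r ∣ f`. -/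
def HasRootOfMult (r : ℕ) (f : MvPolynomial (Fin 2) ℂ) : Prop :=
  ∃ a b : ℂ, (a ≠ 0 ∨ b ≠ 0) ∧ (C a * X 0 + C b * X 1) ^ r ∣ f

/-- The covariant `k = (f,f)₈ ∈ V₄` of a binary decimic `f`. -/
noncomputable def covK (f : MvPolynomial (Fin 2) ℂ) : MvPolynomial (Fin 2) ℂ :=
  transv 10 10 8 f f

/-- The covariant `m = (f,k)₄ ∈ V₆` of a binary decimic `f`. -/
noncomputable def covM (f : MvPolynomial (Fin 2) ℂ) : MvPolynomial (Fin 2) ℂ :=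
  transv 10 4 4 f (covK f)

/-- The covariant `q = (f,f)₆ ∈ V₈` of a binary decimic `f`. -/
noncomputable def covQ (f : MvPolynomial (Fin 2) ℂ) : MvPolynomial (Fin 2) ℂ :=
  transv 10 10 6 f f

/-- The covariant `r = (f,q)₈ ∈ V₂` of a binary decimic `f`. -/
noncomputable def covR (f : MvPolynomial (Fin 2) ℂ) : MvPolynomial (Fin 2) ℂ :=
  transv 10 8 8 f (covQ f)

/-- The covariant `k_q = (q,q)₆ ∈ V₄` of a binary decimic `f`. -/
noncomputable def covKq (f : MvPolynomial (Fin 2) ℂ) : MvPolynomial (Fin 2) ℂ :=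
  transv 8 8 6 (covQ f) (covQ f)

/-- The covariant `k_m = (m,m)₄ ∈ V₄` of a binary decimic `f`. -/
noncomputable def covKm (f : MvPolynomial (Fin 2) ℂ) : MvPolynomial (Fin 2) ℂ :=
  transv 6 6 4 (covM f) (covM f)

/-- The covariant `m_q = (q,k_q)₄ ∈ V₄` of a binary decimic `f`. -/
noncomputable def covMq (f : MvPolynomial (Fin 2) ℂ) : MvPolynomial (Fin 2) ℂ :=
  transv 8 4 4 (covQ f) (covKq f)

/-- The invariant `j₂ = (f,f)₁₀` of a binary decimic `f` (a form of order 0, i.e. a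
constant polynomial). -/
noncomputable def j2 (f : MvPolynomial (Fin 2) ℂ) : MvPolynomial (Fin 2) ℂ :=
  transv 10 10 10 f f

/-- The invariant `j₄ = (k,k)₄` of a binary decimic `f`. -/
noncomputable def j4 (f : MvPolynomial (Fin 2) ℂ) : MvPolynomial (Fin 2) ℂ :=
  transv 4 4 4 (covK f) (covK f)

/-- The invariant `j₆ = ((k,k)₂,k)₄` of a binary decimic `f`. -/
noncomputable def j6 (f : MvPolynomial (Fin 2) ℂ) : MvPolynomial (Fin 2) ℂ :=
  transv 4 4 4 (transv 4 4 2 (covK f) (covK f)) (covK f)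

/-- The invariant `A₆ = (m,m)₆` of a binary decimic `f`. -/
noncomputable def A6 (f : MvPolynomial (Fin 2) ℂ) : MvPolynomial (Fin 2) ℂ :=
  transv 6 6 6 (covM f) (covM f)

/-- The invariant `B₆ = ((q,q)₄,q)₈` of a binary decimic `f`. -/
noncomputable def B6 (f : MvPolynomial (Fin 2) ℂ) : MvPolynomial (Fin 2) ℂ :=
  transv 8 8 8 (transv 8 8 4 (covQ f) (covQ f)) (covQ f)

/-- The invariant `C₆ = (r,r)₂` of a binary decimic `f`. -/
noncomputable def C6 (f : MvPolynomial (Fin 2) ℂ) : MvPolynomial (Fin 2) ℂ :=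
  transv 2 2 2 (covR f) (covR f)

/-- The invariant `j₈ = (k,k_m)₄` of a binary decimic `f`. -/
noncomputable def j8 (f : MvPolynomial (Fin 2) ℂ) : MvPolynomial (Fin 2) ℂ :=
  transv 4 4 4 (covK f) (covKm f)

/-- The invariant `j₉ = ((m,k)₁,k²)₈` of a binary decimic `f`. -/
noncomputable def j9 (f : MvPolynomial (Fin 2) ℂ) : MvPolynomial (Fin 2) ℂ :=
  transv 8 8 8 (transv 6 4 1 (covM f) (covK f)) (covK f ^ 2)

/-- The invariant `j₁₀ = ((m,m)₂,k²)₈` of a binary decimic `f`. -/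
noncomputable def j10 (f : MvPolynomial (Fin 2) ℂ) : MvPolynomial (Fin 2) ℂ :=
  transv 8 8 8 (transv 6 6 2 (covM f) (covM f)) (covK f ^ 2)

/-- The invariant `A₁₂ = (m²,k³)₁₂` of a binary decimic `f`. -/
noncomputable def A12 (f : MvPolynomial (Fin 2) ℂ) : MvPolynomial (Fin 2) ℂ :=
  transv 12 12 12 (covM f ^ 2) (covK f ^ 3)

/-- The invariant `j₁₄ = ((k_q,k_q)₂,m_q)₄` of a binary decimic `f`. -/
noncomputable def j14 (f : MvPolynomial (Fin 2) ℂ) : MvPolynomial (Fin 2) ℂ :=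
  transv 4 4 4 (transv 4 4 2 (covKq f) (covKq f)) (covMq f)

/-- The invariant `A₁₄ = (((k,k)₂)²,(m,m)₂)₈` of a binary decimic `f`. -/
noncomputable def A14 (f : MvPolynomial (Fin 2) ℂ) : MvPolynomial (Fin 2) ℂ :=
  transv 8 8 8 (transv 4 4 2 (covK f) (covK f) ^ 2) (transv 6 6 2 (covM f) (covM f))

/-- The term `c x^a y^b` of a binary form. -/
noncomputable def binaryTerm (c : ℂ) (a b : ℕ) : MvPolynomial (Fin 2) ℂ :=
  C c * X 0 ^ a * X 1 ^ b

/-- The structure constant of the `k`-th transvectant of `x^a y^b` and `x^a' y^b'`. -/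
noncomputable def transvCoeff (n m k a b a' b' : ℕ) : ℂ :=
  ((((n - k).factorial * (m - k).factorial : ℕ) : ℂ) / ((n.factorial * m.factorial : ℕ) : ℂ)) *
    ∑ i ∈ Finset.range (k + 1), (-1 : ℂ) ^ i * (k.choose i : ℂ) *
      ((b.descFactorial i * a.descFactorial (k - i) *
        (b'.descFactorial (k - i) * a'.descFactorial i) : ℕ) : ℂ)

theorem binaryTerm_zero (a b : ℕ) : binaryTerm 0 a b = 0 := by
  simp [binaryTerm]

theorem binaryTerm_add (c d : ℂ) (a b : ℕ) :
    binaryTerm c a b + binaryTerm d a b = binaryTerm (c + d) a b := by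
  simp only [binaryTerm, map_add]
  ring

theorem binaryTerm_mul (c c' : ℂ) (a b a' b' : ℕ) :
    binaryTerm c a b * binaryTerm c' a' b' = binaryTerm (c * c') (a + a') (b + b') := by
  simp only [binaryTerm, map_mul]
  ring

theorem binaryTerm_pow (c : ℂ) (a b n : ℕ) :
    binaryTerm c a b ^ n = binaryTerm (c ^ n) (a * n) (b * n) := by
  simp only [binaryTerm, map_pow, mul_pow, ← pow_mul]

theorem smul_binaryTerm (s c : ℂ) (a b : ℕ) :
    s • binaryTerm c a b = binaryTerm (s * c) a b := by
  simp only [binaryTerm, smul_eq_C_mul, map_mul, mul_assoc]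

theorem iterate_pderiv_zero_binaryTerm (c : ℂ) (a b i : ℕ) :
    (fun p => pderiv (0 : Fin 2) p)^[i] (binaryTerm c a b) =
      binaryTerm (c * a.descFactorial i) (a - i) b := by
  induction i with
  | zero => simp
  | succ i ih =>
    rw [Function.iterate_succ_apply', ih]
    simp [binaryTerm, Nat.descFactorial_succ, Nat.sub_sub]
    ring

theorem iterate_pderiv_one_binaryTerm (c : ℂ) (a b i : ℕ) :
    (fun p => pderiv (1 : Fin 2) p)^[i] (binaryTerm c a b) =
      binaryTerm (c * b.descFactorial i) a (b - i) := by
  induction i with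
  | zero => simp
  | succ i ih =>
    rw [Function.iterate_succ_apply', ih]
    simp [binaryTerm, Nat.descFactorial_succ, Nat.sub_sub]
    ring

theorem transv_binaryTerm (n m k : ℕ) (c c' : ℂ) (a b a' b' : ℕ) :
    transv n m k (binaryTerm c a b) (binaryTerm c' a' b') =
      binaryTerm (c * c' * transvCoeff n m k a b a' b') (a + a' - k) (b + b' - k) := by
  have key : ∀ i ∈ Finset.range (k + 1),
      ((-1 : ℂ) ^ i * (k.choose i : ℂ)) •
        ((fun p => pderiv (0 : Fin 2) p)^[k - i]
            ((fun p => pderiv (1 : Fin 2) p)^[i] (binaryTerm c a b)) *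
          (fun p => pderiv (0 : Fin 2) p)^[i]
            ((fun p => pderiv (1 : Fin 2) p)^[k - i] (binaryTerm c' a' b'))) =
      ((-1 : ℂ) ^ i * (k.choose i : ℂ) *
        ((b.descFactorial i * a.descFactorial (k - i) *
          (b'.descFactorial (k - i) * a'.descFactorial i) : ℕ) : ℂ)) •
        binaryTerm (c * c') (a + a' - k) (b + b' - k) := by
    intro i hi
    have hi : i ≤ k := Nat.lt_succ_iff.mp (Finset.mem_range.mp hi)
    rw [iterate_pderiv_one_binaryTerm, iterate_pderiv_zero_binaryTerm,
      iterate_pderiv_one_binaryTerm, iterate_pderiv_zero_binaryTerm, binaryTerm_mul,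
      smul_binaryTerm, smul_binaryTerm]
    by_cases h : i ≤ b ∧ k - i ≤ a ∧ k - i ≤ b' ∧ i ≤ a'
    · obtain ⟨h₁, h₂, h₃, h₄⟩ := h
      rw [show a - (k - i) + (a' - i) = a + a' - k by omega,
        show b - i + (b' - (k - i)) = b + b' - k by omega]
      push_cast
      ring_nf
    · have h0 : b.descFactorial i = 0 ∨ a.descFactorial (k - i) = 0 ∨
          b'.descFactorial (k - i) = 0 ∨ a'.descFactorial i = 0 := by
        simp only [Nat.descFactorial_eq_zero_iff_lt]
        omega
      rcases h0 with h0 | h0 | h0 | h0 <;> simp [h0, binaryTerm_zero]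
  rw [transv, Finset.sum_congr rfl key, ← Finset.sum_smul, smul_smul, smul_binaryTerm,
    transvCoeff]
  congr 1
  ring

theorem transvCoeff_eq_zero {n m k a b a' b' : ℕ} (h : a + a' < k ∨ b + b' < k) :
    transvCoeff n m k a b a' b' = 0 := by
  rw [transvCoeff, Finset.sum_eq_zero, mul_zero]
  intro i hi
  have hi : i ≤ k := Nat.lt_succ_iff.mp (Finset.mem_range.mp hi)
  have h0 : b.descFactorial i = 0 ∨ a.descFactorial (k - i) = 0 ∨
      b'.descFactorial (k - i) = 0 ∨ a'.descFactorial i = 0 := by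
    simp only [Nat.descFactorial_eq_zero_iff_lt]
    omega
  rcases h0 with h0 | h0 | h0 | h0 <;> simp [h0]

theorem transv_binaryTerm_eq_zero {n m k : ℕ} {c c' : ℂ} {a b a' b' : ℕ}
    (h : a + a' < k ∨ b + b' < k) :
    transv n m k (binaryTerm c a b) (binaryTerm c' a' b') = 0 := by
  rw [transv_binaryTerm, transvCoeff_eq_zero h, mul_zero, binaryTerm_zero]

theorem iterate_pderiv_add (j : Fin 2) (i : ℕ) (f g : MvPolynomial (Fin 2) ℂ) :
    (fun p => pderiv j p)^[i] (f + g) =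
      (fun p => pderiv j p)^[i] f + (fun p => pderiv j p)^[i] g :=
  iterate_map_add (pderiv (R := ℂ) j) i f g

theorem transv_add_left (n m k : ℕ) (f g h : MvPolynomial (Fin 2) ℂ) :
    transv n m k (f + g) h = transv n m k f h + transv n m k g h := by
  simp only [transv, iterate_pderiv_add, add_mul, smul_add, Finset.sum_add_distrib]

theorem transv_add_right (n m k : ℕ) (f g h : MvPolynomial (Fin 2) ℂ) :
    transv n m k f (g + h) = transv n m k f g + transv n m k f h := by
  simp only [transv, iterate_pderiv_add, mul_add, smul_add, Finset.sum_add_distrib]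

theorem transv_zero_right (n m k : ℕ) (f : MvPolynomial (Fin 2) ℂ) :
    transv n m k f 0 = 0 := by
  simpa using transv_add_right n m k f 0 0

section

variable (α β : ℂ)

/-- The decimic `x² y (α x⁷ + β y⁷)`, written as a sum of two terms. -/
noncomputable def twoTermDecimic : MvPolynomial (Fin 2) ℂ :=
  binaryTerm α 9 1 + binaryTerm β 2 8

theorem transv_twoTermDecimic_self (k : ℕ) (hk : 4 < k) :
    transv 10 10 k (twoTermDecimic α β) (twoTermDecimic α β) =
      binaryTerm (α * β * (transvCoeff 10 10 k 9 1 2 8 + transvCoeff 10 10 k 2 8 9 1))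
        (11 - k) (9 - k) := by
  rw [twoTermDecimic, transv_add_left, transv_add_right, transv_add_right,
    transv_binaryTerm_eq_zero (a := 9) (a' := 9) (by omega),
    transv_binaryTerm_eq_zero (a := 2) (a' := 2) (by omega),
    transv_binaryTerm, transv_binaryTerm, zero_add, add_zero, binaryTerm_add]
  congr 1
  ring

theorem covQ_twoTermDecimic : ∃ c, covQ (twoTermDecimic α β) = binaryTerm c 5 3 :=
  ⟨_, transv_twoTermDecimic_self α β 6 (by norm_num)⟩

theorem covK_twoTermDecimic :
    ∃ c : ℂ, c ≠ 0 ∧ covK (twoTermDecimic α β) = binaryTerm (α * β * c) 3 1 := by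
  refine ⟨_, ?_, transv_twoTermDecimic_self α β 8 (by norm_num)⟩
  norm_num [transvCoeff, Finset.sum_range_succ, Nat.choose, Nat.descFactorial, Nat.factorial]

theorem covM_twoTermDecimic :
    ∃ c : ℂ, c ≠ 0 ∧ covM (twoTermDecimic α β) = binaryTerm (α * β ^ 2 * c) 1 5 := by
  obtain ⟨c, hc, hk⟩ := covK_twoTermDecimic α β
  refine ⟨c * transvCoeff 10 4 4 2 8 3 1, mul_ne_zero hc ?_, ?_⟩
  · norm_num [transvCoeff, Finset.sum_range_succ, Nat.choose, Nat.descFactorial, Nat.factorial]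
  · rw [covM, hk, twoTermDecimic, transv_add_left, transv_binaryTerm_eq_zero (by omega),
      transv_binaryTerm, zero_add]
    congr 1
    ring

end

/-- For `f = x²y(αx⁷ + βy⁷) ∈ V₁₀`, the ten invariants `j₂, j₄, j₆, A₆, B₆, j₈, j₉,
j₁₀, A₁₂, j₁₄` all vanish at `f`, while `A₁₄(f) ≠ 0` if and only if `α ≠ 0` and
`β ≠ 0`. (Hence `A₁₄` cannot be omitted from the eleven invariants defining the
nullcone of `V₁₀`.) -/
theorem A14_needed (α β : ℂ)
    (f : MvPolynomial (Fin 2) ℂ)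
    (hf : f = X 0 ^ 2 * X 1 * (C α * X 0 ^ 7 + C β * X 1 ^ 7)) :
    (j2 f = 0 ∧ j4 f = 0 ∧ j6 f = 0 ∧ A6 f = 0 ∧ B6 f = 0 ∧ j8 f = 0 ∧ j9 f = 0 ∧
      j10 f = 0 ∧ A12 f = 0 ∧ j14 f = 0) ∧
    (A14 f ≠ 0 ↔ (α ≠ 0 ∧ β ≠ 0)) := by
  have hf : f = twoTermDecimic α β := by
    rw [hf, twoTermDecimic, binaryTerm, binaryTerm]
    ring
  subst hf
  obtain ⟨q, hq⟩ := covQ_twoTermDecimic α β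
  obtain ⟨k, hk0, hk⟩ := covK_twoTermDecimic α β
  obtain ⟨m, hm0, hm⟩ := covM_twoTermDecimic α β
  refine ⟨⟨?_, ?_, ?_, ?_, ?_, ?_, ?_, ?_, ?_, ?_⟩, ?_⟩
  · rw [j2, transv_twoTermDecimic_self α β 10 (by norm_num), transvCoeff_eq_zero (by omega),
      transvCoeff_eq_zero (by omega), add_zero, mul_zero, binaryTerm_zero]
  · rw [j4, hk, transv_binaryTerm_eq_zero (by omega)]
  · rw [j6, hk, transv_binaryTerm, transv_binaryTerm_eq_zero (by omega)]
  · rw [A6, hm, transv_binaryTerm_eq_zero (by omega)]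
  · rw [B6, hq, transv_binaryTerm, transv_binaryTerm_eq_zero (by omega)]
  · rw [j8, covKm, hm, transv_binaryTerm_eq_zero (a := 1) (by omega), transv_zero_right]
  · rw [j9, hm, hk, transv_binaryTerm, binaryTerm_pow, transv_binaryTerm_eq_zero (by omega)]
  · rw [j10, hm, hk, transv_binaryTerm, binaryTerm_pow, transv_binaryTerm_eq_zero (by omega)]
  · rw [A12, hm, hk, binaryTerm_pow, binaryTerm_pow, transv_binaryTerm_eq_zero (by omega)]
  · rw [j14, covMq, covKq, hq, transv_binaryTerm (a := 5) (a' := 5),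
      transv_binaryTerm_eq_zero (a := 5) (by omega), transv_zero_right]
  · have hkk : transvCoeff 4 4 2 3 1 3 1 ≠ 0 := by
      norm_num [transvCoeff, Finset.sum_range_succ, Nat.choose, Nat.descFactorial, Nat.factorial]
    have hmm : transvCoeff 6 6 2 1 5 1 5 ≠ 0 := by
      norm_num [transvCoeff, Finset.sum_range_succ, Nat.choose, Nat.descFactorial, Nat.factorial]
    have htop : transvCoeff 8 8 8 8 0 0 8 ≠ 0 := by
      norm_num [transvCoeff, Finset.sum_range_succ, Nat.choose, Nat.descFactorial, Nat.factorial]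
    rw [A14, hk, hm, transv_binaryTerm, transv_binaryTerm, binaryTerm_pow, transv_binaryTerm]
    simp [binaryTerm, hkk, hmm, htop, hk0, hm0]
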